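/- Let (w^n_j) be a solution of the θ-scheme with 0 ≤ B(ξ) ≤ 1 for all ξ ∈ ℝ and with the CFL condition λ(1−θ) < 1/2, λ = Δt/(Δx)². Set z^n_j = (w^n_{j+1} − w^n_j)/Δx and let z̄^{Δt} : [0,1] × [0,∞) → ℝ be the piecewise constant interpolation z̄^{Δt}(x,t) = z^n_j for x ∈ [x_j, x_{j+1}), t ∈ [nΔt, (n+1)Δt). Then for every continuously differentiable 1-periodic function φ : ℝ → ℝ and all 0 ≤ t₁ ≤ t₂, |∫₀¹ (z̄^{Δt}(x, t₂) − z̄^{Δt}(x, t₁)) φ(x) dx| ≤ ‖φ'‖_{L^∞} · (∑_{j ∈ ZMod N} |z^0_{j+1} − z^0_j|) · (t₂ − t₁ + 2Δt). -/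

import Mathlib

set_option autoImplicit false

/-- Grid spacing `Δx = 1/N` on the periodic domain `[0,1]`. -/
noncomputable def gridDx (N : ℕ) : ℝ := 1 / N

/-- `(w n j)` is a solution of the θ-scheme `D_t^+ w^n_j = B(w^{n+θ}_j) D² w^{n+θ}_j`
for `w_t = B(w) w_xx` on a periodic grid of `N` cells, where
`w^{n+θ}_j = θ w^{n+1}_j + (1-θ) w^n_j` and
`D² a_j = (a_{j+1} - 2 a_j + a_{j-1})/(Δx)²`. -/
def IsThetaScheme (N : ℕ) (θ Δt : ℝ) (B : ℝ → ℝ) (w : ℕ → ZMod N → ℝ) : Prop :=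
  ∀ (n : ℕ) (j : ZMod N),
    (w (n + 1) j - w n j) / Δt =
      B (θ * w (n + 1) j + (1 - θ) * w n j) *
        (((θ * w (n + 1) (j + 1) + (1 - θ) * w n (j + 1))
          - 2 * (θ * w (n + 1) j + (1 - θ) * w n j)
          + (θ * w (n + 1) (j - 1) + (1 - θ) * w n (j - 1))) / (gridDx N) ^ 2)

/-- The undivided periodic second difference. -/
def secondDiff {N : ℕ} (a : ZMod N → ℝ) (j : ZMod N) : ℝ := a (j + 1) - 2 * a j + a (j - 1)

lemma sum_shift_add {N : ℕ} [NeZero N] (f : ZMod N → ℝ) : ∑ j, f (j + 1) = ∑ j, f j :=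
  Equiv.sum_comp (Equiv.addRight (1 : ZMod N)) f

lemma sum_shift_sub {N : ℕ} [NeZero N] (f : ZMod N → ℝ) : ∑ j, f (j - 1) = ∑ j, f j :=
  Equiv.sum_comp (Equiv.subRight (1 : ZMod N)) f

lemma sum_secondDiff {N : ℕ} [NeZero N] (f : ZMod N → ℝ) : ∑ j, secondDiff f j = 0 := by
  simp only [secondDiff, Finset.sum_add_distrib, Finset.sum_sub_distrib, ← Finset.mul_sum,
    sum_shift_add, sum_shift_sub]
  ring

/-- The θ-step `s' = s + Δ(c (θ s' + (1 - θ) s))` contracts the `ℓ¹` norm as soon as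
the explicit part has nonnegative coefficients. -/
lemma sum_abs_le_of_theta_step {N : ℕ} [NeZero N] {θ : ℝ} (hθ0 : 0 ≤ θ) (hθ1 : θ ≤ 1)
    {c s s' : ZMod N → ℝ} (hc : ∀ j, 0 ≤ c j) (hcfl : ∀ j, 2 * (1 - θ) * c j ≤ 1)
    (h : ∀ j, s' j = s j + secondDiff (fun i => c i * (θ * s' i + (1 - θ) * s i)) j) :
    ∑ j, |s' j| ≤ ∑ j, |s j| := by
  have key : ∀ j, |s' j| - θ * secondDiff (fun i => c i * |s' i|) j
      ≤ |s j| + (1 - θ) * secondDiff (fun i => c i * |s i|) j := by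
    intro j
    have h1θ : 0 ≤ 1 - θ := by linarith
    have a1 := mul_nonneg hθ0 (hc (j + 1))
    have a2 := mul_nonneg hθ0 (hc (j - 1))
    have a0 := mul_nonneg hθ0 (hc j)
    have b1 := mul_nonneg h1θ (hc (j + 1))
    have b2 := mul_nonneg h1θ (hc (j - 1))
    have b0 : 0 ≤ 1 - 2 * (1 - θ) * c j := by linarith [hcfl j]
    have e : (1 + 2 * (θ * c j)) * s' j =
        θ * c (j + 1) * s' (j + 1) + θ * c (j - 1) * s' (j - 1)
        + (1 - 2 * (1 - θ) * c j) * s j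
        + (1 - θ) * c (j + 1) * s (j + 1) + (1 - θ) * c (j - 1) * s (j - 1) := by
      have := h j
      simp only [secondDiff] at this
      linear_combination this
    have e' := congrArg abs e
    rw [abs_mul, abs_of_nonneg (by linarith : 0 ≤ 1 + 2 * (θ * c j))] at e'
    have t1 := abs_mul (θ * c (j + 1)) (s' (j + 1))
    have t2 := abs_mul (θ * c (j - 1)) (s' (j - 1))
    have t3 := abs_mul (1 - 2 * (1 - θ) * c j) (s j)
    have t4 := abs_mul ((1 - θ) * c (j + 1)) (s (j + 1))
    have t5 := abs_mul ((1 - θ) * c (j - 1)) (s (j - 1))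
    rw [abs_of_nonneg a1] at t1
    rw [abs_of_nonneg a2] at t2
    rw [abs_of_nonneg b0] at t3
    rw [abs_of_nonneg b1] at t4
    rw [abs_of_nonneg b2] at t5
    have u := abs_add_le (θ * c (j + 1) * s' (j + 1) + θ * c (j - 1) * s' (j - 1)
        + (1 - 2 * (1 - θ) * c j) * s j + (1 - θ) * c (j + 1) * s (j + 1))
        ((1 - θ) * c (j - 1) * s (j - 1))
    have v := abs_add_le (θ * c (j + 1) * s' (j + 1) + θ * c (j - 1) * s' (j - 1)
        + (1 - 2 * (1 - θ) * c j) * s j) ((1 - θ) * c (j + 1) * s (j + 1))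
    have x := abs_add_three (θ * c (j + 1) * s' (j + 1)) (θ * c (j - 1) * s' (j - 1))
        ((1 - 2 * (1 - θ) * c j) * s j)
    simp only [secondDiff]
    linarith
  have := Finset.sum_le_sum fun j (_ : j ∈ Finset.univ) => key j
  rwa [Finset.sum_sub_distrib, Finset.sum_add_distrib, ← Finset.mul_sum, ← Finset.mul_sum,
    sum_secondDiff, sum_secondDiff, mul_zero, mul_zero, sub_zero, add_zero] at this

lemma gridDx_pos (N : ℕ) [NeZero N] : 0 < gridDx N :=
  one_div_pos.2 (Nat.cast_pos.2 (NeZero.pos N))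

section ThetaScheme

variable {N : ℕ} {θ Δt : ℝ} {B : ℝ → ℝ} {w : ℕ → ZMod N → ℝ}

lemma IsThetaScheme.step (hw : IsThetaScheme N θ Δt B w) (hΔt : 0 < Δt) (n : ℕ) (j : ZMod N) :
    w (n + 1) j = w n j + Δt / gridDx N ^ 2 * B (θ * w (n + 1) j + (1 - θ) * w n j) *
      (θ * secondDiff (w (n + 1)) j + (1 - θ) * secondDiff (w n) j) := by
  have h := hw n j
  rw [div_eq_iff hΔt.ne'] at h
  simp only [secondDiff]
  linear_combination h

variable [NeZero N]

lemma IsThetaScheme.sum_abs_secondDiff_le (hw : IsThetaScheme N θ Δt B w) (hΔt : 0 < Δt)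
    (hθ0 : 0 ≤ θ) (hθ1 : θ ≤ 1) (hB0 : ∀ ξ, 0 ≤ B ξ) (hB1 : ∀ ξ, B ξ ≤ 1)
    (hCFL : Δt / gridDx N ^ 2 * (1 - θ) ≤ 1 / 2) (n : ℕ) :
    ∑ j, |secondDiff (w n) j| ≤ ∑ j, |secondDiff (w 0) j| := by
  induction n with
  | zero => exact le_rfl
  | succ n ih =>
    refine le_trans (sum_abs_le_of_theta_step hθ0 hθ1
      (c := fun j => Δt / gridDx N ^ 2 * B (θ * w (n + 1) j + (1 - θ) * w n j))
      (fun j => mul_nonneg (by positivity) (hB0 _)) (fun j => ?_) (fun j => ?_)) ih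
    · have h0 : 0 ≤ Δt / gridDx N ^ 2 * (1 - θ) := mul_nonneg (by positivity) (by linarith)
      have := mul_le_of_le_one_right h0 (hB1 (θ * w (n + 1) j + (1 - θ) * w n j))
      linarith
    · have h1 := hw.step hΔt n (j + 1)
      have h2 := hw.step hΔt n j
      have h3 := hw.step hΔt n (j - 1)
      conv_lhs => rw [secondDiff]
      conv_rhs => rw [secondDiff]
      conv_rhs => rw [secondDiff]
      linear_combination h1 - 2 * h2 + h3

lemma IsThetaScheme.sum_abs_step_le (hw : IsThetaScheme N θ Δt B w) (hΔt : 0 < Δt)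
    (hθ0 : 0 ≤ θ) (hθ1 : θ ≤ 1) (hB0 : ∀ ξ, 0 ≤ B ξ) (hB1 : ∀ ξ, B ξ ≤ 1)
    (hCFL : Δt / gridDx N ^ 2 * (1 - θ) ≤ 1 / 2) (n : ℕ) :
    ∑ j, |w (n + 1) j - w n j| ≤ Δt / gridDx N ^ 2 * ∑ j, |secondDiff (w 0) j| := by
  have h1θ : 0 ≤ 1 - θ := by linarith
  have hl : 0 ≤ Δt / gridDx N ^ 2 := by positivity
  have hS := hw.sum_abs_secondDiff_le hΔt hθ0 hθ1 hB0 hB1 hCFL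
  calc ∑ j, |w (n + 1) j - w n j|
      ≤ ∑ j, Δt / gridDx N ^ 2 *
        (θ * |secondDiff (w (n + 1)) j| + (1 - θ) * |secondDiff (w n) j|) := by
        refine Finset.sum_le_sum fun j _ => ?_
        have e : w (n + 1) j - w n j = Δt / gridDx N ^ 2 *
            (B (θ * w (n + 1) j + (1 - θ) * w n j) *
            (θ * secondDiff (w (n + 1)) j + (1 - θ) * secondDiff (w n) j)) := by
          linear_combination hw.step hΔt n j
        rw [e, abs_mul, abs_mul, abs_of_nonneg hl, abs_of_nonneg (hB0 _)]
        refine mul_le_mul_of_nonneg_left ?_ hl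
        refine (mul_le_of_le_one_left (abs_nonneg _) (hB1 _)).trans ((abs_add_le _ _).trans ?_)
        rw [abs_mul, abs_mul, abs_of_nonneg hθ0, abs_of_nonneg h1θ]
    _ = Δt / gridDx N ^ 2 * (θ * ∑ j, |secondDiff (w (n + 1)) j|
        + (1 - θ) * ∑ j, |secondDiff (w n) j|) := by
        rw [← Finset.mul_sum, Finset.sum_add_distrib, ← Finset.mul_sum, ← Finset.mul_sum]
    _ ≤ Δt / gridDx N ^ 2 * ∑ j, |secondDiff (w 0) j| := by
        refine mul_le_mul_of_nonneg_left ?_ hl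
        have := mul_le_mul_of_nonneg_left (hS (n + 1)) hθ0
        have := mul_le_mul_of_nonneg_left (hS n) h1θ
        linarith

lemma IsThetaScheme.sum_abs_sub_le (hw : IsThetaScheme N θ Δt B w) (hΔt : 0 < Δt)
    (hθ0 : 0 ≤ θ) (hθ1 : θ ≤ 1) (hB0 : ∀ ξ, 0 ≤ B ξ) (hB1 : ∀ ξ, B ξ ≤ 1)
    (hCFL : Δt / gridDx N ^ 2 * (1 - θ) ≤ 1 / 2) {m n : ℕ} (hmn : m ≤ n) :
    ∑ j, |w n j - w m j| ≤
      ((n : ℝ) - m) * (Δt / gridDx N ^ 2 * ∑ j, |secondDiff (w 0) j|) := by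
  induction n, hmn using Nat.le_induction with
  | base => simp
  | succ n _ ih =>
    have h := hw.sum_abs_step_le hΔt hθ0 hθ1 hB0 hB1 hCFL n
    have : ∑ j, |w (n + 1) j - w m j| ≤
        ∑ j, |w (n + 1) j - w n j| + ∑ j, |w n j - w m j| := by
      rw [← Finset.sum_add_distrib]
      exact Finset.sum_le_sum fun j _ => abs_sub_le _ _ _
    push_cast
    linarith

end ThetaScheme

open intervalIntegral in
/-- The cell integrals of a function with `|φ'| ≤ M` differ by at most `M h²` between neighbours. -/
lemma abs_integral_shift_sub_le {φ : ℝ → ℝ} (hφ : ContDiff ℝ 1 φ) {M : ℝ}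
    (hM : ∀ x, |deriv φ x| ≤ M) {h : ℝ} (hh : 0 ≤ h) (x : ℝ) :
    |(∫ y in (x + h)..(x + h + h), φ y) - ∫ y in x..(x + h), φ y| ≤ M * h ^ 2 := by
  have hc := hφ.continuous
  have hc' : Continuous fun y => φ (y + h) := by fun_prop
  rw [← integral_comp_add_right (fun y => φ y) h,
    ← integral_sub (hc'.intervalIntegrable _ _) (hc.intervalIntegrable _ _)]
  have := norm_integral_le_of_norm_le_const (a := x) (b := x + h) (C := M * h)
    (f := fun y => φ (y + h) - φ y) fun y _ => by
      have := Convex.norm_image_sub_le_of_norm_deriv_le (f := φ) (C := M) (s := Set.univ)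
        (x := y) (y := y + h) (fun z _ => (hφ.differentiable one_ne_zero) z)
        (fun z _ => hM z) convex_univ (Set.mem_univ _) (Set.mem_univ _)
      simpa [abs_of_nonneg hh] using this
  rw [Real.norm_eq_abs] at this
  refine this.trans (le_of_eq ?_)
  rw [add_sub_cancel_left, abs_of_nonneg hh]
  ring

/-- The integral over `[0, 1]` of `φ` weighted by a function that is constant on each grid cell. -/
lemma integral_piecewise_mul {N : ℕ} [NeZero N] {g φ : ℝ → ℝ} (hφ : Continuous φ)
    {a : ZMod N → ℝ}
    (hg : ∀ j : ZMod N, ∀ x ∈ Set.Ico ((j.val : ℝ) / N) (((j.val : ℝ) + 1) / N), g x = a j) :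
    ∫ x in (0 : ℝ)..1, g x * φ x =
      ∑ j : ZMod N, a j * ∫ x in ((j.val : ℝ) / N)..((j.val : ℝ) / N + gridDx N), φ x := by
  have hN : (0 : ℝ) < N := Nat.cast_pos.2 (NeZero.pos N)
  have hae : ∀ j : ZMod N, ∀ᵐ x ∂(MeasureTheory.volume.restrict
      (Set.uIoc ((j.val : ℝ) / N) (((j.val : ℝ) + 1) / N))), a j * φ x = g x * φ x := by
    intro j
    have hle : (j.val : ℝ) / N ≤ ((j.val : ℝ) + 1) / N := by gcongr; linarith
    rw [Set.uIoc_of_le hle, ← MeasureTheory.restrict_Ioo_eq_restrict_Ioc]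
    filter_upwards [MeasureTheory.ae_restrict_mem measurableSet_Ioo] with x hx
    rw [hg j x (Set.Ioo_subset_Ico_self hx)]
  have hint : ∀ k < N, IntervalIntegrable (fun x => g x * φ x) MeasureTheory.volume
      ((k : ℝ) / N) (((k + 1 : ℕ) : ℝ) / N) := by
    intro k hk
    have h := hae (k : ZMod N)
    rw [ZMod.val_cast_of_lt hk] at h
    push_cast
    exact ((hφ.const_mul (a k)).intervalIntegrable _ _).congr_ae h
  have hsum := intervalIntegral.sum_integral_adjacent_intervals
    (a := fun k : ℕ => (k : ℝ) / N) hint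
  simp only [Nat.cast_zero, zero_div, div_self hN.ne'] at hsum
  rw [← hsum]
  symm
  refine Finset.sum_nbij' (fun j => j.val) (fun k => (k : ZMod N)) ?_ ?_ ?_ ?_ ?_
  · exact fun j _ => Finset.mem_range.2 (ZMod.val_lt j)
  · simp
  · intro j _
    simp
  · exact fun k hk => ZMod.val_cast_of_lt (Finset.mem_range.1 hk)
  · intro j _
    rw [gridDx, ← add_div, ← intervalIntegral.integral_const_mul]
    push_cast
    exact intervalIntegral.integral_congr_ae_restrict (hae j)

lemma integral_cell_add_one {N : ℕ} [NeZero N] {φ : ℝ → ℝ} (hφper : ∀ x, φ (x + 1) = φ x)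
    (j : ZMod N) :
    ∫ x in (((j + 1).val : ℝ) / N)..(((j + 1).val : ℝ) / N + gridDx N), φ x =
      ∫ x in ((j.val : ℝ) / N + gridDx N)..((j.val : ℝ) / N + gridDx N + gridDx N), φ x := by
  have hN : (N : ℝ) ≠ 0 := Nat.cast_ne_zero.2 (NeZero.ne N)
  have hval : (j + 1).val = (j.val + 1) % N := by
    rw [ZMod.val_add, ZMod.val_one_eq_one_mod, Nat.add_mod_mod]
  have e : (j.val : ℝ) / N + gridDx N = ((j.val + 1 : ℕ) : ℝ) / N := by
    rw [gridDx]; push_cast; ring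
  rw [e]
  rcases (Nat.succ_le_of_lt (ZMod.val_lt j)).lt_or_eq with h | h
  · rw [hval, Nat.mod_eq_of_lt h]
  · have h' : j.val + 1 = N := h
    rw [hval, h', Nat.mod_self, div_self hN, Nat.cast_zero, zero_div, zero_add]
    rw [show ∫ x in (0 : ℝ)..gridDx N, φ x = ∫ x in (0 : ℝ)..gridDx N, φ (x + 1) by
      simp only [hφper], intervalIntegral.integral_comp_add_right, zero_add, add_comm]

/-- **Weak time continuity of the piecewise constant interpolation of `z = D₊w`.**
Let `Z` be the piecewise constant interpolation (in `x` and `t`) of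
`z^n_j = (w^n_{j+1} - w^n_j)/Δx` for a θ-scheme solution. Then for every `C¹`,
1-periodic test function `φ` with `|φ'| ≤ M` and all `0 ≤ t₁ ≤ t₂`,
`|∫₀¹ (Z(x,t₂) - Z(x,t₁)) φ(x) dx| ≤ M ⬝ (∑_j |z⁰_{j+1} - z⁰_j|) ⬝ (t₂ - t₁ + 2Δt)`. -/
theorem z_weak_time_continuity (N : ℕ) [NeZero N] (hN : 2 ≤ N)
    (θ Δt : ℝ) (hθ0 : 0 ≤ θ) (hθ1 : θ ≤ 1) (hΔt : 0 < Δt)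
    (B : ℝ → ℝ) (hB0 : ∀ ξ : ℝ, 0 ≤ B ξ) (hB1 : ∀ ξ : ℝ, B ξ ≤ 1)
    (hCFL : Δt / (gridDx N) ^ 2 * (1 - θ) < 1 / 2)
    (w : ℕ → ZMod N → ℝ) (hw : IsThetaScheme N θ Δt B w)
    (z : ℕ → ZMod N → ℝ)
    (hz : ∀ (n : ℕ) (j : ZMod N), z n j = (w n (j + 1) - w n j) / gridDx N)
    (Z : ℝ → ℝ → ℝ)
    (hZ : ∀ (n : ℕ) (j : ZMod N),
      ∀ x ∈ Set.Ico ((j.val : ℝ) / N) (((j.val : ℝ) + 1) / N),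
      ∀ t ∈ Set.Ico ((n : ℝ) * Δt) (((n : ℝ) + 1) * Δt),
      Z x t = z n j)
    (φ : ℝ → ℝ) (hφ : ContDiff ℝ 1 φ) (hφper : ∀ x : ℝ, φ (x + 1) = φ x)
    (M : ℝ) (hM : ∀ x : ℝ, |deriv φ x| ≤ M)
    (t₁ t₂ : ℝ) (ht₁ : 0 ≤ t₁) (ht₁₂ : t₁ ≤ t₂) :
    |∫ x in (0 : ℝ)..1, (Z x t₂ - Z x t₁) * φ x|
      ≤ M * (∑ j : ZMod N, |z 0 (j + 1) - z 0 j|) * (t₂ - t₁ + 2 * Δt) := by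
  have hx := gridDx_pos N
  set h := gridDx N with hh
  have hM0 : 0 ≤ M := (abs_nonneg _).trans (hM 0)
  have hfl : ∀ t, 0 ≤ t →
      t ∈ Set.Ico ((⌊t / Δt⌋₊ : ℝ) * Δt) (((⌊t / Δt⌋₊ : ℝ) + 1) * Δt) := fun t ht =>
    ⟨(le_div_iff₀ hΔt).1 (Nat.floor_le (by positivity)),
      (div_lt_iff₀ hΔt).1 (Nat.lt_floor_add_one _)⟩
  have ht₂ := ht₁.trans ht₁₂
  have i₁ := hfl t₁ ht₁
  have i₂ := hfl t₂ ht₂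
  have hmn : ⌊t₁ / Δt⌋₊ ≤ ⌊t₂ / Δt⌋₊ := Nat.floor_le_floor (by gcongr)
  set m := ⌊t₁ / Δt⌋₊
  set n := ⌊t₂ / Δt⌋₊
  set Φ : ZMod N → ℝ := fun j => ∫ x in ((j.val : ℝ) / N)..((j.val : ℝ) / N + h), φ x with hΦ
  set Q : ZMod N → ℝ := fun j => w n j - w m j with hQ
  set S := ∑ j : ZMod N, |z 0 (j + 1) - z 0 j|
  have hΦle : ∀ j, |Φ j - Φ (j + 1)| ≤ M * h ^ 2 := fun j => by
    rw [abs_sub_comm]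
    simp only [hΦ]
    rw [integral_cell_add_one hφper]
    exact abs_integral_shift_sub_le hφ hM hx.le _
  have hS : ∑ j, |secondDiff (w 0) j| = h * S := by
    rw [← sum_shift_add, Finset.mul_sum]
    refine Finset.sum_congr rfl fun j _ => ?_
    have e : secondDiff (w 0) (j + 1) = h * (z 0 (j + 1) - z 0 j) := by
      rw [hz, hz, secondDiff, add_sub_cancel_right]
      field_simp
      ring
    rw [e, abs_mul, abs_of_pos hx]
  have hint : ∫ x in (0 : ℝ)..1, (Z x t₂ - Z x t₁) * φ x =
      ∑ j, h⁻¹ * (Q (j + 1) * (Φ j - Φ (j + 1))) := by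
    rw [integral_piecewise_mul (a := fun j => h⁻¹ * (Q (j + 1) - Q j)) hφ.continuous]
    · have := sum_shift_add fun j => h⁻¹ * (Q j * Φ j)
      rw [← sub_eq_zero, ← Finset.sum_sub_distrib] at this ⊢
      rw [← this]
      refine Finset.sum_congr rfl fun j _ => ?_
      simp only [hΦ]
      ring
    · intro j x hxj
      rw [hZ n j x hxj t₂ i₂, hZ m j x hxj t₁ i₁, hz, hz]
      simp only [hQ]
      field_simp
      ring
  have hQle : ∑ j, |Q j| ≤ ((n : ℝ) - m) * (Δt / h ^ 2 * (h * S)) := by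
    rw [← hS]
    exact hw.sum_abs_sub_le hΔt hθ0 hθ1 hB0 hB1 hCFL.le hmn
  have hMS : 0 ≤ M * S := mul_nonneg hM0 (Finset.sum_nonneg fun j _ => abs_nonneg _)
  calc |∫ x in (0 : ℝ)..1, (Z x t₂ - Z x t₁) * φ x|
      ≤ ∑ j, M * h * |Q (j + 1)| := by
        rw [hint]
        refine (Finset.abs_sum_le_sum_abs _ _).trans (Finset.sum_le_sum fun j _ => ?_)
        rw [abs_mul, abs_mul, abs_of_pos (inv_pos.2 hx)]
        calc h⁻¹ * (|Q (j + 1)| * |Φ j - Φ (j + 1)|)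
            ≤ h⁻¹ * (|Q (j + 1)| * (M * h ^ 2)) := by gcongr; exact hΦle j
          _ = M * h * |Q (j + 1)| := by field_simp
    _ = M * h * ∑ j, |Q j| := by rw [← Finset.mul_sum, sum_shift_add fun j => |Q j|]
    _ ≤ M * h * (((n : ℝ) - m) * (Δt / h ^ 2 * (h * S))) := by gcongr
    _ = M * S * (n * Δt - m * Δt) := by field_simp
    _ ≤ M * S * (t₂ - t₁ + 2 * Δt) := by
        refine mul_le_mul_of_nonneg_left ?_ hMS
        have := i₂.1
        have := i₁.2
        linarith
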